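/- arXiv:1504.04406 — 6 statements merged into one kernel-verified Lean document; each statement's English description precedes it below -/
import Mathlib

section
/- Variance bound for the SAGA gradient estimator under an arbitrary sampling distribution: Let E be a real inner product space, let n ≥ 1, and let f_1, …, f_n : E → ℝ be differentiable functions. Let p_1, …, p_n be positive reals with ∑_{j=1}^n p_j = 1. Fix x ∈ E, points φ_1, …, φ_n ∈ E, and a point x* ∈ E with ∑_{i=1}^n ∇f_i(x*) = 0. For each j define ν_j = (1/(n p_j))(∇f_j(x) − ∇f_j(φ_j)) + (1/n)∑_{i=1}^n ∇f_i(φ_i). Then ∑_{j=1}^n p_j ‖ν_j‖² ≤ 2 ∑_{j=1}^n p_j ‖(1/(n p_j))(∇f_j(x) − ∇f_j(x*))‖² + 2 ∑_{j=1}^n p_j ‖(1/(n p_j))(∇f_j(φ_j) − ∇f_j(x*))‖². -/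
open scoped BigOperators

/-- The variance of a finitely supported random vector is at most its second moment. -/
theorem sum_mul_norm_sub_mean_sq_le {ι E : Type*} [Fintype ι]
    [NormedAddCommGroup E] [InnerProductSpace ℝ E]
    (p : ι → ℝ) (hps : ∑ j, p j = 1) (b : ι → E) :
    ∑ j, p j * ‖b j - ∑ i, p i • b i‖ ^ 2 ≤ ∑ j, p j * ‖b j‖ ^ 2 := by
  set m := ∑ i, p i • b i with hm
  have hinner : ∑ j, p j * inner ℝ (b j) m = ‖m‖ ^ 2 := by
    rw [← real_inner_self_eq_norm_sq]
    conv_rhs => rw [hm, sum_inner]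
    simp only [real_inner_smul_left, ← hm]
  have hexpand : ∑ j, p j * ‖b j - m‖ ^ 2 = ∑ j, p j * ‖b j‖ ^ 2 - ‖m‖ ^ 2 := by
    calc ∑ j, p j * ‖b j - m‖ ^ 2
        = ∑ j, (p j * ‖b j‖ ^ 2 - 2 * (p j * inner ℝ (b j) m) + p j * ‖m‖ ^ 2) := by
          refine Finset.sum_congr rfl fun j _ => ?_
          rw [norm_sub_sq_real]
          ring
      _ = ∑ j, p j * ‖b j‖ ^ 2 - ‖m‖ ^ 2 := by
          rw [Finset.sum_add_distrib, Finset.sum_sub_distrib, ← Finset.mul_sum,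
            ← Finset.sum_mul, hinner, hps]
          ring
  rw [hexpand]
  linarith [sq_nonneg ‖m‖]

theorem norm_sub_sq_le_two_mul {E : Type*} [NormedAddCommGroup E] [InnerProductSpace ℝ E]
    (a b : E) : ‖a - b‖ ^ 2 ≤ 2 * ‖a‖ ^ 2 + 2 * ‖b‖ ^ 2 := by
  have h := parallelogram_law_with_norm ℝ a b
  nlinarith [sq_nonneg ‖a + b‖]

/-- Variance bound for the SAGA gradient estimator under an arbitrary sampling
distribution. -/
theorem saga_estimator_variance_bound
    {E : Type*} [NormedAddCommGroup E] [InnerProductSpace ℝ E] [CompleteSpace E]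
    {n : ℕ} (hn : 1 ≤ n)
    (f : Fin n → E → ℝ) (hdiff : ∀ i, Differentiable ℝ (f i))
    (p : Fin n → ℝ) (hp : ∀ j, 0 < p j) (hps : ∑ j, p j = 1)
    (x : E) (φ : Fin n → E) (xstar : E)
    (hstar : ∑ i, gradient (f i) xstar = 0)
    (ν : Fin n → E)
    (hν : ∀ j, ν j = (1 / (n * p j)) • (gradient (f j) x - gradient (f j) (φ j))
        + (1 / n : ℝ) • ∑ i, gradient (f i) (φ i)) :
    ∑ j, p j * ‖ν j‖ ^ 2 ≤
      2 * ∑ j, p j * ‖(1 / (n * p j)) • (gradient (f j) x - gradient (f j) xstar)‖ ^ 2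
      + 2 * ∑ j, p j * ‖(1 / (n * p j)) • (gradient (f j) (φ j) - gradient (f j) xstar)‖ ^ 2 := by
  set a : Fin n → E := fun j => (1 / (n * p j)) • (gradient (f j) x - gradient (f j) xstar)
  set b : Fin n → E :=
    fun j => (1 / (n * p j)) • (gradient (f j) (φ j) - gradient (f j) xstar) with hb
  have hn0 : (n : ℝ) ≠ 0 := by
    exact_mod_cast Nat.one_le_iff_ne_zero.mp hn
  have hmean : ∑ i, p i • b i = (1 / n : ℝ) • ∑ i, gradient (f i) (φ i) := by
    have hterm : ∀ i, p i • b i =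
        (1 / n : ℝ) • (gradient (f i) (φ i) - gradient (f i) xstar) := fun i => by
      have hpi := (hp i).ne'
      rw [hb, smul_smul]
      congr 1
      field_simp
    simp only [hterm]
    rw [← Finset.smul_sum, Finset.sum_sub_distrib, hstar, sub_zero]
  have hsplit : ∀ j, ν j = a j - (b j - ∑ i, p i • b i) := fun j => by
    rw [hν, hmean]
    simp only [a, b, smul_sub]
    abel
  have hpoint : ∀ j, p j * ‖ν j‖ ^ 2 ≤
      2 * (p j * ‖a j‖ ^ 2) + 2 * (p j * ‖b j - ∑ i, p i • b i‖ ^ 2) := fun j => by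
    rw [hsplit j]
    linarith [mul_le_mul_of_nonneg_left
      (norm_sub_sq_le_two_mul (a j) (b j - ∑ i, p i • b i)) (hp j).le]
  calc ∑ j, p j * ‖ν j‖ ^ 2
      ≤ ∑ j, (2 * (p j * ‖a j‖ ^ 2) + 2 * (p j * ‖b j - ∑ i, p i • b i‖ ^ 2)) :=
        Finset.sum_le_sum fun j _ => hpoint j
    _ = 2 * ∑ j, p j * ‖a j‖ ^ 2 + 2 * ∑ j, p j * ‖b j - ∑ i, p i • b i‖ ^ 2 := by
        rw [Finset.sum_add_distrib, ← Finset.mul_sum, ← Finset.mul_sum]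
    _ ≤ 2 * ∑ j, p j * ‖a j‖ ^ 2 + 2 * ∑ j, p j * ‖b j‖ ^ 2 := by
        linarith [sum_mul_norm_sub_mean_sq_le p hps b]
end

section
/- Strongly convex inner-product bound with uniform smoothness: Let E be a real inner product space, let n ≥ 1, and let f_1, …, f_n : E → ℝ each be μ-strongly convex and differentiable with L-Lipschitz continuous gradient, where 0 < μ ≤ L. Let f = (1/n)∑_{i=1}^n f_i and let x* be a minimizer of f. Then for every x ∈ E, ⟨∇f(x), x* − x⟩ ≤ −(μ/2)‖x − x*‖² − (1/(2Ln)) ∑_{i=1}^n ‖∇f_i(x*) − ∇f_i(x)‖². -/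
open scoped BigOperators RealInnerProductSpace

section GradientInequalities

variable {E : Type*} [NormedAddCommGroup E] [InnerProductSpace ℝ E] [CompleteSpace E]

/-- The derivative of a function along a line, in terms of its gradient. -/
theorem HasGradientAt.hasDerivAt_add_smul {g : E → ℝ} {g' x d : E} {t : ℝ}
    (h : HasGradientAt g g' (x + t • d)) :
    HasDerivAt (fun s : ℝ => g (x + s • d)) ⟪g', d⟫ t := by
  have hline : HasDerivAt (fun s : ℝ => x + s • d) d t := by
    simpa using ((hasDerivAt_id t).smul_const d).const_add x
  simpa [Function.comp_def] using h.hasFDerivAt.comp_hasDerivAt t hline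

/-- First-order characterization of convexity: the graph lies above its tangent planes. -/
theorem ConvexOn.add_inner_le_of_hasGradientAt {g : E → ℝ} {g' x : E}
    (hg : ConvexOn ℝ Set.univ g) (h : HasGradientAt g g' x) (y : E) :
    g x + ⟪g', y - x⟫ ≤ g y := by
  have hconv : ConvexOn ℝ Set.univ (fun s : ℝ => g (x + s • (y - x))) := by
    have := hg.comp_affineMap (AffineMap.lineMap x y : ℝ →ᵃ[ℝ] E)
    simpa [Function.comp_def, AffineMap.lineMap_apply, add_comm] using this
  have hderiv : HasDerivAt (fun s : ℝ => g (x + s • (y - x))) ⟪g', y - x⟫ 0 :=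
    HasGradientAt.hasDerivAt_add_smul (by simpa using h)
  have := hconv.le_slope_of_hasDerivAt (Set.mem_univ 0) (Set.mem_univ 1) one_pos hderiv
  simp only [slope_def_field, one_smul, zero_smul, add_zero, add_sub_cancel, sub_zero,
    div_one] at this
  linarith

/-- First-order lower bound for a strongly convex function. -/
theorem add_inner_add_sq_le_of_strongly_convex {g : E → ℝ} {g' x : E} {μ : ℝ}
    (hg : ConvexOn ℝ Set.univ (fun w => g w - μ / 2 * ‖w‖ ^ 2)) (h : HasGradientAt g g' x)
    (y : E) : g x + ⟪g', y - x⟫ + μ / 2 * ‖y - x‖ ^ 2 ≤ g y := by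
  have hgrad : HasGradientAt (fun w => g w - μ / 2 * ‖w‖ ^ 2) (g' - μ • x) x := by
    rw [hasGradientAt_iff_hasFDerivAt]
    refine (h.hasFDerivAt.sub
      ((hasStrictFDerivAt_norm_sq x).hasFDerivAt.const_mul (μ / 2))).congr_fderiv ?_
    ext v
    simp
    ring
  have := hg.add_inner_le_of_hasGradientAt hgrad y
  rw [norm_sub_sq_real]
  simp only [inner_sub_left, inner_sub_right, real_inner_smul_left,
    real_inner_self_eq_norm_sq] at this ⊢
  rw [real_inner_comm y x] at this
  linarith

/-- The descent lemma: quadratic upper bound for a function with Lipschitz gradient. -/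
theorem le_add_inner_add_sq_of_lipschitz_gradient {g : E → ℝ} {L : ℝ}
    (hg : Differentiable ℝ g)
    (hlip : ∀ w v : E, ‖gradient g w - gradient g v‖ ≤ L * ‖w - v‖) (x y : E) :
    g y ≤ g x + ⟪gradient g x, y - x⟫ + L / 2 * ‖y - x‖ ^ 2 := by
  set d := y - x with hd
  have hderiv : ∀ t : ℝ, HasDerivAt
      (fun s : ℝ => g (x + s • d) - (s * ⟪gradient g x, d⟫ + L / 2 * ‖d‖ ^ 2 * s ^ 2))
      (⟪gradient g (x + t • d), d⟫ - (⟪gradient g x, d⟫ + L * t * ‖d‖ ^ 2)) t := by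
    intro t
    have h₁ := (hg (x + t • d)).hasGradientAt.hasDerivAt_add_smul
    have h₂ := ((hasDerivAt_id t).mul_const ⟪gradient g x, d⟫).add
      ((hasDerivAt_pow 2 t).const_mul (L / 2 * ‖d‖ ^ 2))
    refine (h₁.sub h₂).congr_deriv ?_
    simp
    ring
  have hanti := antitoneOn_of_deriv_nonpos (convex_Icc (0 : ℝ) 1)
    (fun t _ => (hderiv t).continuousAt.continuousWithinAt)
    (fun t _ => (hderiv t).differentiableAt.differentiableWithinAt) (by
      intro t ht
      rw [interior_Icc] at ht
      rw [(hderiv t).deriv]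
      have h₁ := real_inner_le_norm (gradient g (x + t • d) - gradient g x) d
      have h₂ := mul_le_mul_of_nonneg_right (hlip (x + t • d) x) (norm_nonneg d)
      rw [add_sub_cancel_left, norm_smul, Real.norm_of_nonneg ht.1.le] at h₂
      rw [inner_sub_left] at h₁
      nlinarith)
  have := hanti (Set.left_mem_Icc.2 zero_le_one) (Set.right_mem_Icc.2 zero_le_one) zero_le_one
  simp only [zero_smul, add_zero, one_smul, hd, add_sub_cancel] at this
  linarith

/-- A differentiable function above its tangent planes with `L`-Lipschitz gradient exceeds its
tangent planes by a multiple of the squared gradient difference. -/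
theorem add_inner_add_gradient_sub_sq_le {g : E → ℝ} {L : ℝ} (hL : 0 < L)
    (hg : Differentiable ℝ g) (htan : ∀ w v : E, g w + ⟪gradient g w, v - w⟫ ≤ g v)
    (hlip : ∀ w v : E, ‖gradient g w - gradient g v‖ ≤ L * ‖w - v‖) (x y : E) :
    g x + ⟪gradient g x, y - x⟫ + 1 / (2 * L) * ‖gradient g x - gradient g y‖ ^ 2 ≤ g y := by
  set e := gradient g x - gradient g y with he
  have hlow := htan x (y + L⁻¹ • e)
  have hup := le_add_inner_add_sq_of_lipschitz_gradient hg hlip y (y + L⁻¹ • e)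
  rw [add_sub_cancel_left, norm_smul, Real.norm_of_nonneg (inv_nonneg.2 hL.le),
    real_inner_smul_right] at hup
  rw [add_sub_right_comm, inner_add_right, real_inner_smul_right] at hlow
  have hinner : ⟪gradient g x, e⟫ - ⟪gradient g y, e⟫ = ‖e‖ ^ 2 := by
    rw [← inner_sub_left, ← he, real_inner_self_eq_norm_sq]
  have hsum : L⁻¹ * ⟪gradient g x, e⟫ - L⁻¹ * ⟪gradient g y, e⟫ = L⁻¹ * ‖e‖ ^ 2 := by
    rw [← mul_sub, hinner]
  have hcoef : L / 2 * (L⁻¹ * ‖e‖) ^ 2 = L⁻¹ * ‖e‖ ^ 2 - 1 / (2 * L) * ‖e‖ ^ 2 := by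
    field_simp
    ring
  linarith

end GradientInequalities

/-- Strongly convex inner-product bound with uniform smoothness (inequality (4)
of the paper). -/
theorem strongly_convex_inner_bound_uniform
    {E : Type*} [NormedAddCommGroup E] [InnerProductSpace ℝ E] [CompleteSpace E]
    {n : ℕ} (hn : 1 ≤ n)
    (f : Fin n → E → ℝ) (μ L : ℝ) (hμ : 0 < μ) (hμL : μ ≤ L)
    (hdiff : ∀ i, Differentiable ℝ (f i))
    (hsc : ∀ i, ConvexOn ℝ Set.univ (fun w => f i w - μ / 2 * ‖w‖ ^ 2))
    (hlip : ∀ i, ∀ w v : E, ‖gradient (f i) w - gradient (f i) v‖ ≤ L * ‖w - v‖)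
    (fbar : E → ℝ) (hfbar : fbar = fun w => (1 / n : ℝ) * ∑ i, f i w)
    (xstar : E) (hmin : ∀ w, fbar xstar ≤ fbar w) (x : E) :
    ⟪gradient fbar x, xstar - x⟫ ≤
      -(μ / 2) * ‖x - xstar‖ ^ 2
        - (1 / (2 * L * n)) * ∑ i, ‖gradient (f i) xstar - gradient (f i) x‖ ^ 2 := by
  have hn0 : (0 : ℝ) < n := by exact_mod_cast hn
  have hL : 0 < L := hμ.trans_le hμL
  have hgrad : ∀ w, HasGradientAt fbar ((1 / n : ℝ) • ∑ i, gradient (f i) w) w := by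
    intro w
    rw [hasGradientAt_iff_hasFDerivAt, hfbar]
    refine ((HasFDerivAt.fun_sum fun i (_ : i ∈ Finset.univ) =>
      (hdiff i w).hasGradientAt.hasFDerivAt).const_mul (1 / n : ℝ)).congr_fderiv ?_
    simp
  have hcrit : ∑ i, gradient (f i) xstar = 0 := by
    have hloc : IsLocalMin fbar xstar := Filter.Eventually.of_forall hmin
    have hzero := hloc.hasFDerivAt_eq_zero (hgrad xstar).hasFDerivAt
    rw [LinearIsometryEquiv.map_eq_zero_iff] at hzero
    exact (smul_eq_zero.1 hzero).resolve_left (by positivity)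
  have hstrong : ∀ i, ∀ w v : E,
      f i w + ⟪gradient (f i) w, v - w⟫ + μ / 2 * ‖v - w‖ ^ 2 ≤ f i v := fun i w v =>
    add_inner_add_sq_le_of_strongly_convex (hsc i) (hdiff i w).hasGradientAt v
  have htan : ∀ i, ∀ w v : E, f i w + ⟪gradient (f i) w, v - w⟫ ≤ f i v := fun i w v =>
    (le_add_of_nonneg_right (by positivity)).trans (hstrong i w v)
  have h₁ := Finset.sum_le_sum fun i (_ : i ∈ Finset.univ) => hstrong i x xstar
  have h₂ := Finset.sum_le_sum fun i (_ : i ∈ Finset.univ) =>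
    add_inner_add_gradient_sub_sq_le hL (hdiff i) (htan i) (hlip i) xstar x
  simp only [Finset.sum_add_distrib, ← sum_inner, ← Finset.mul_sum, Finset.sum_const,
    Finset.card_univ, Fintype.card_fin, nsmul_eq_mul, hcrit, inner_zero_left] at h₁ h₂
  rw [(hgrad x).gradient, real_inner_smul_left, norm_sub_rev x xstar]
  have hkey : ⟪∑ i, gradient (f i) x, xstar - x⟫ ≤ -(n * (μ / 2 * ‖xstar - x‖ ^ 2))
      - 1 / (2 * L) * ∑ i, ‖gradient (f i) xstar - gradient (f i) x‖ ^ 2 := by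
    linarith
  refine (mul_le_mul_of_nonneg_left hkey (by positivity : (0 : ℝ) ≤ 1 / n)).trans_eq ?_
  field_simp
end

section
/- Strongly convex inner-product bound with per-function smoothness constants: Let E be a real inner product space, let n ≥ 1, and let f_1, …, f_n : E → ℝ be convex and differentiable, with ∇f_i Lipschitz continuous with constant L_i > 0. Suppose f = (1/n)∑_{i=1}^n f_i is μ-strongly convex with μ > 0, and let x* be the minimizer of f. Then for every x ∈ E, ⟨∇f(x), x* − x⟩ ≤ f(x*) − f(x) − (μ/4)‖x* − x‖² − (1/(4n)) ∑_{i=1}^n (1/L_i)‖∇f_i(x*) − ∇f_i(x)‖². -/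
open scoped BigOperators RealInnerProductSpace

/-- First-order characterization of convexity: a convex function lies above its tangent. -/
theorem ConvexOn.fderiv_le_sub {F : Type*} [NormedAddCommGroup F] [NormedSpace ℝ F]
    {g : F → ℝ} {g' : F →L[ℝ] ℝ} {x : F} (hg : ConvexOn ℝ Set.univ g)
    (hg' : HasFDerivAt g g' x) (y : F) : g' (y - x) ≤ g y - g x := by
  have hline : HasDerivAt (fun t : ℝ => g (AffineMap.lineMap x y t)) (g' (y - x)) 0 := by
    have hx : HasFDerivAt g g' (AffineMap.lineMap x y (0 : ℝ)) := by simpa using hg'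
    exact hx.comp_hasDerivAt 0 AffineMap.hasDerivAt_lineMap
  have hconv : ConvexOn ℝ Set.univ (fun t : ℝ => g (AffineMap.lineMap x y t)) :=
    hg.comp_affineMap (AffineMap.lineMap x y)
  have h := hconv.le_slope_of_hasDerivAt (Set.mem_univ 0) (Set.mem_univ 1) zero_lt_one hline
  simpa [slope_def_field] using h

section InnerProductSpace

variable {E : Type*} [NormedAddCommGroup E] [InnerProductSpace ℝ E] [CompleteSpace E]

/-- First-order characterization of strong convexity. -/
theorem inner_gradient_le_sub_of_strongConvex {g : E → ℝ} {m : ℝ}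
    (hg : ConvexOn ℝ Set.univ (fun w => g w - m / 2 * ‖w‖ ^ 2)) {x : E}
    (hd : DifferentiableAt ℝ g x) (y : E) :
    ⟪gradient g x, y - x⟫ ≤ g y - g x - m / 2 * ‖y - x‖ ^ 2 := by
  have hder := hd.hasFDerivAt.sub
    ((hasStrictFDerivAt_norm_sq x).hasFDerivAt.const_mul (m / 2))
  have h := hg.fderiv_le_sub hder y
  simp only [sub_apply, smul_apply, innerSL_apply_apply,
    inner_sub_right, real_inner_self_eq_norm_sq, smul_eq_mul, nsmul_eq_mul] at h
  rw [inner_gradient_left, norm_sub_sq_real, real_inner_comm]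
  push_cast at h
  linarith

/-- The descent lemma: a function with `L`-Lipschitz gradient lies below its quadratic model. -/
theorem le_add_inner_gradient_add_of_lipschitz {g : E → ℝ} {L : ℝ} (hd : Differentiable ℝ g)
    (hlip : ∀ w v : E, ‖gradient g w - gradient g v‖ ≤ L * ‖w - v‖) (x y : E) :
    g y ≤ g x + ⟪gradient g x, y - x⟫ + L / 2 * ‖y - x‖ ^ 2 := by
  set d := y - x with hdef
  let φ : ℝ → ℝ := fun t => g (x + t • d) - t * ⟪gradient g x, d⟫ - L / 2 * ‖d‖ ^ 2 * t ^ 2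
  have hφ (t : ℝ) : HasDerivAt φ
      (⟪gradient g (x + t • d) - gradient g x, d⟫ - L * t * ‖d‖ ^ 2) t := by
    have hline : HasDerivAt (fun s : ℝ => x + s • d) d t := by
      simpa using ((hasDerivAt_id t).smul_const d).const_add x
    have hcomp := (hd (x + t • d)).hasFDerivAt.comp_hasDerivAt t hline
    refine ((hcomp.sub ((hasDerivAt_id t).mul_const ⟪gradient g x, d⟫)).sub
      ((hasDerivAt_pow 2 t).const_mul (L / 2 * ‖d‖ ^ 2))).congr_deriv ?_
    simp only [inner_sub_left, inner_gradient_left]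
    push_cast
    ring
  have hanti : AntitoneOn φ (Set.Ici 0) := by
    refine antitoneOn_of_deriv_nonpos (convex_Ici 0)
      (fun t _ => (hφ t).continuousAt.continuousWithinAt)
      (fun t _ => (hφ t).differentiableAt.differentiableWithinAt) fun t ht => ?_
    rw [interior_Ici] at ht
    have hnorm : ‖gradient g (x + t • d) - gradient g x‖ ≤ L * (t * ‖d‖) := by
      simpa [norm_smul, abs_of_pos (Set.mem_Ioi.mp ht)] using hlip (x + t • d) x
    rw [(hφ t).deriv, sub_nonpos]
    calc ⟪gradient g (x + t • d) - gradient g x, d⟫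
        ≤ ‖gradient g (x + t • d) - gradient g x‖ * ‖d‖ := real_inner_le_norm _ _
      _ ≤ L * (t * ‖d‖) * ‖d‖ := by gcongr
      _ = L * t * ‖d‖ ^ 2 := by ring
  have h := hanti (Set.mem_Ici.mpr le_rfl) (Set.mem_Ici.mpr zero_le_one) zero_le_one
  simp only [φ, one_smul, zero_smul, add_zero, hdef, add_sub_cancel] at h
  linarith

/-- Convex functions with `L`-Lipschitz gradient lie above their tangents by at least
`‖∇g y - ∇g x‖² / (2L)`. -/
theorem inner_gradient_le_sub_of_convex_of_lipschitz {g : E → ℝ} {L : ℝ} (hL : 0 < L)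
    (hg : ConvexOn ℝ Set.univ g) (hd : Differentiable ℝ g)
    (hlip : ∀ w v : E, ‖gradient g w - gradient g v‖ ≤ L * ‖w - v‖) (x y : E) :
    ⟪gradient g x, y - x⟫ ≤
      g y - g x - 1 / 2 * (1 / L * ‖gradient g y - gradient g x‖ ^ 2) := by
  set D := gradient g y - gradient g x with hD
  have hlower := hg.fderiv_le_sub (hd x).hasFDerivAt (y - L⁻¹ • D)
  have hupper := le_add_inner_gradient_add_of_lipschitz hd hlip y (y - L⁻¹ • D)
  rw [← inner_gradient_left, sub_right_comm, inner_sub_right, real_inner_smul_right] at hlower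
  rw [sub_sub_cancel_left, inner_neg_right, real_inner_smul_right, norm_neg, norm_smul,
    Real.norm_of_nonneg (inv_nonneg.mpr hL.le)] at hupper
  have hinner : ⟪gradient g y, D⟫ - ⟪gradient g x, D⟫ = ‖D‖ ^ 2 := by
    rw [← inner_sub_left, real_inner_self_eq_norm_sq]
  have hquad : L / 2 * (L⁻¹ * ‖D‖) ^ 2 = 1 / 2 * (L⁻¹ * ‖D‖ ^ 2) := by
    field_simp
  have hscaled := congrArg (L⁻¹ * ·) hinner
  simp only [mul_sub] at hscaled
  rw [one_div L]
  linarith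

end InnerProductSpace

/-- Strongly convex inner-product bound with per-function smoothness constants
(inequality (7) of Appendix B). -/
theorem strongly_convex_inner_bound_per_function
    {E : Type*} [NormedAddCommGroup E] [InnerProductSpace ℝ E] [CompleteSpace E]
    {n : ℕ} (hn : 1 ≤ n)
    (f : Fin n → E → ℝ) (Lc : Fin n → ℝ) (hL : ∀ i, 0 < Lc i)
    (hconv : ∀ i, ConvexOn ℝ Set.univ (f i))
    (hdiff : ∀ i, Differentiable ℝ (f i))
    (hlip : ∀ i, ∀ w v : E, ‖gradient (f i) w - gradient (f i) v‖ ≤ Lc i * ‖w - v‖)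
    (fbar : E → ℝ) (hfbar : fbar = fun w => (1 / n : ℝ) * ∑ i, f i w)
    (μ : ℝ) (hμ : 0 < μ)
    (hsc : ConvexOn ℝ Set.univ (fun w => fbar w - μ / 2 * ‖w‖ ^ 2))
    (xstar : E) (hmin : ∀ w, fbar xstar ≤ fbar w) (x : E) :
    ⟪gradient fbar x, xstar - x⟫ ≤
      fbar xstar - fbar x - (μ / 4) * ‖xstar - x‖ ^ 2
        - (1 / (4 * n)) * ∑ i, (1 / Lc i) * ‖gradient (f i) xstar - gradient (f i) x‖ ^ 2 := by
  have hder : HasFDerivAt fbar ((1 / n : ℝ) • ∑ i, fderiv ℝ (f i) x) x := by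
    rw [hfbar]
    exact (HasFDerivAt.fun_sum fun i _ => (hdiff i x).hasFDerivAt).const_mul _
  have hstrong := inner_gradient_le_sub_of_strongConvex hsc hder.differentiableAt xstar
  have hsmooth : ⟪gradient fbar x, xstar - x⟫ ≤ fbar xstar - fbar x -
      (1 / n : ℝ) * (1 / 2 * ∑ i, 1 / Lc i * ‖gradient (f i) xstar - gradient (f i) x‖ ^ 2) := by
    have hsum := Finset.sum_le_sum fun i (_ : i ∈ Finset.univ) =>
      inner_gradient_le_sub_of_convex_of_lipschitz (hL i) (hconv i) (hdiff i) (hlip i) x xstar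
    rw [Finset.sum_sub_distrib, Finset.sum_sub_distrib, ← Finset.mul_sum] at hsum
    have hmean := mul_le_mul_of_nonneg_left hsum (by positivity : (0 : ℝ) ≤ 1 / n)
    rw [inner_gradient_left, hder.fderiv, hfbar]
    simp only [inner_gradient_left] at hmean
    simp only [smul_apply, sum_apply, smul_eq_mul]
    linarith
  have hcoef : (1 / (4 * n) : ℝ) = 1 / n / 4 := by ring
  rw [hcoef]
  linarith
end

section
/- Step-size bound for SAGA with Lipschitz sampling (Lemma 2 of Appendix B): Let E be a real inner product space, let n ≥ 1, let f_1, …, f_n : E → ℝ be differentiable, let L_1, …, L_n > 0, and set L̄ = (1/n)∑_{i=1}^n L_i. Let the sampling probabilities be p_j = L_j/(n L̄). Fix x ∈ E, points φ_1, …, φ_n ∈ E, a point x* ∈ E with ∑_{i=1}^n ∇f_i(x*) = 0, and a step size γ > 0. For each j define ν_j = (L̄/L_j)(∇f_j(x) − ∇f_j(φ_j)) + (1/n)∑_{i=1}^n ∇f_i(φ_i) and x⁺_j = x − γ ν_j. Then ∑_{j=1}^n p_j ‖x⁺_j − x‖² ≤ 2γ²(L̄/n)∑_{i=1}^n (1/L_i)‖∇f_i(φ_i)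 − ∇f_i(x*)‖² + 2γ²(L̄/n)∑_{i=1}^n (1/L_i)‖∇f_i(x) − ∇f_i(x*)‖² − γ²‖∇f(x)‖², where f = (1/n)∑_{i=1}^n f_i. -/
open scoped BigOperators

/-- Weighted second-moment bound: recentring `W` at its weighted mean and applying the parallelogram
inequality to the two centred families. -/
theorem sum_weighted_norm_sub_add_mean_sq_le
    {ι E : Type*} [Fintype ι] [NormedAddCommGroup E] [InnerProductSpace ℝ E]
    (p : ι → ℝ) (hp : ∀ i, 0 ≤ p i) (hsum : ∑ i, p i = 1) (X W : ι → E) :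
    ∑ i, p i * ‖X i - W i + ∑ k, p k • W k‖ ^ 2 ≤
      2 * ∑ i, p i * ‖W i‖ ^ 2 + 2 * ∑ i, p i * ‖X i‖ ^ 2 - ‖∑ i, p i • X i‖ ^ 2 := by
  have inner_mean (Z : ι → E) (c : E) :
      ∑ i, p i * inner ℝ (Z i) c = inner ℝ (∑ i, p i • Z i) c := by
    simp [sum_inner, real_inner_smul_left]
  have hXG := inner_mean X (∑ i, p i • X i)
  have hWB := inner_mean W (∑ i, p i • W i)
  have hWG := inner_mean W (∑ i, p i • X i)
  set G := ∑ i, p i • X i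
  set B := ∑ i, p i • W i
  rw [real_inner_self_eq_norm_sq] at hXG hWB
  have pointwise (i : ι) : ‖X i - W i + B‖ ^ 2 ≤
      2 * ‖W i‖ ^ 2 + 2 * ‖X i‖ ^ 2 - 2 * inner ℝ (X i) G - 4 * inner ℝ (W i) B
        - 2 * inner ℝ (W i) G + (2 * ‖B‖ ^ 2 + 2 * inner ℝ B G + ‖G‖ ^ 2) := by
    have h := sq_nonneg ‖(X i - G) + (W i - B)‖
    simp only [← real_inner_self_eq_norm_sq, inner_add_left, inner_add_right, inner_sub_left,
      inner_sub_right] at h ⊢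
    linarith [real_inner_comm (X i) G, real_inner_comm (X i) B, real_inner_comm (W i) G,
      real_inner_comm (W i) B, real_inner_comm (X i) (W i), real_inner_comm B G]
  calc ∑ i, p i * ‖X i - W i + B‖ ^ 2
      ≤ ∑ i, (2 * (p i * ‖W i‖ ^ 2) + 2 * (p i * ‖X i‖ ^ 2) - 2 * (p i * inner ℝ (X i) G)
          - 4 * (p i * inner ℝ (W i) B) - 2 * (p i * inner ℝ (W i) G)
          + p i * (2 * ‖B‖ ^ 2 + 2 * inner ℝ B G + ‖G‖ ^ 2)) :=
        Finset.sum_le_sum fun i _ =>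
          (mul_le_mul_of_nonneg_left (pointwise i) (hp i)).trans_eq (by ring)
    _ = 2 * ∑ i, p i * ‖W i‖ ^ 2 + 2 * ∑ i, p i * ‖X i‖ ^ 2 - ‖G‖ ^ 2 - 2 * ‖B‖ ^ 2 := by
        simp only [Finset.sum_add_distrib, Finset.sum_sub_distrib, ← Finset.mul_sum,
          ← Finset.sum_mul, hsum, hXG, hWB, hWG]
        ring
    _ ≤ _ := by linarith [sq_nonneg ‖B‖]

/-- The gradient of a scaled finite sum of differentiable functions. -/
theorem gradient_const_mul_sum
    {ι E : Type*} [Fintype ι] [NormedAddCommGroup E] [InnerProductSpace ℝ E] [CompleteSpace E]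
    (f : ι → E → ℝ) (c : ℝ) (x : E) (hf : ∀ i, DifferentiableAt ℝ (f i) x) :
    gradient (fun w => c * ∑ i, f i w) x = c • ∑ i, gradient (f i) x := by
  have h : HasFDerivAt (fun w => c * ∑ i, f i w) (c • ∑ i, fderiv ℝ (f i) x) x :=
    (HasFDerivAt.fun_sum fun i _ => (hf i).hasFDerivAt).const_mul c
  simp [gradient, h.fderiv]

/-- Step-size bound for SAGA with Lipschitz sampling (Lemma 2 of Appendix B). -/
theorem saga_lipschitz_sampling_step_bound
    {E : Type*} [NormedAddCommGroup E] [InnerProductSpace ℝ E] [CompleteSpace E]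
    {n : ℕ} (hn : 1 ≤ n)
    (f : Fin n → E → ℝ) (hdiff : ∀ i, Differentiable ℝ (f i))
    (Lc : Fin n → ℝ) (hL : ∀ i, 0 < Lc i)
    (Lbar : ℝ) (hLbar : Lbar = (1 / n : ℝ) * ∑ i, Lc i)
    (p : Fin n → ℝ) (hp : ∀ j, p j = Lc j / (n * Lbar))
    (fbar : E → ℝ) (hfbar : fbar = fun w => (1 / n : ℝ) * ∑ i, f i w)
    (x : E) (φ : Fin n → E) (xstar : E)
    (hstar : ∑ i, gradient (f i) xstar = 0)
    (γ : ℝ) (hγ : 0 < γ)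
    (ν : Fin n → E)
    (hν : ∀ j, ν j = (Lbar / Lc j) • (gradient (f j) x - gradient (f j) (φ j))
        + (1 / n : ℝ) • ∑ i, gradient (f i) (φ i))
    (xplus : Fin n → E) (hxplus : ∀ j, xplus j = x - γ • ν j) :
    ∑ j, p j * ‖xplus j - x‖ ^ 2 ≤
      2 * γ ^ 2 * (Lbar / n) * ∑ i, (1 / Lc i) * ‖gradient (f i) (φ i) - gradient (f i) xstar‖ ^ 2
      + 2 * γ ^ 2 * (Lbar / n) * ∑ i, (1 / Lc i) * ‖gradient (f i) x - gradient (f i) xstar‖ ^ 2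
      - γ ^ 2 * ‖gradient fbar x‖ ^ 2 := by
  have hn0 : (0 : ℝ) < n := by exact_mod_cast hn
  have hS : 0 < ∑ i, Lc i :=
    Finset.sum_pos (fun i _ => hL i) ⟨⟨0, hn⟩, Finset.mem_univ _⟩
  have hLbar0 : 0 < Lbar := hLbar ▸ by positivity
  have hSL : ∑ i, Lc i = n * Lbar := by rw [hLbar]; field_simp
  have hp0 (i : Fin n) : 0 ≤ p i := by
    rw [hp]; have := hL i; positivity
  have hp1 : ∑ i, p i = 1 := by
    simp only [hp]
    rw [← Finset.sum_div, hSL, div_self (by positivity)]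
  have mean (a : Fin n → E) : ∑ i, p i • (Lbar / Lc i) • a i = (1 / n : ℝ) • ∑ i, a i := by
    rw [Finset.smul_sum]
    refine Finset.sum_congr rfl fun i _ => ?_
    have := hL i
    rw [smul_smul, hp]
    congr 1
    field_simp
  have moment (a : Fin n → E) : ∑ i, p i * ‖(Lbar / Lc i) • a i‖ ^ 2 =
      (Lbar / n) * ∑ i, (1 / Lc i) * ‖a i‖ ^ 2 := by
    rw [Finset.mul_sum]
    refine Finset.sum_congr rfl fun i _ => ?_
    have := hL i
    rw [norm_smul, mul_pow, Real.norm_eq_abs, sq_abs, hp]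
    field_simp
  have hG : gradient fbar x = (1 / n : ℝ) • ∑ i, (gradient (f i) x - gradient (f i) xstar) := by
    rw [hfbar, gradient_const_mul_sum f _ x fun i => (hdiff i) x, Finset.sum_sub_distrib, hstar,
      sub_zero]
  have key := sum_weighted_norm_sub_add_mean_sq_le p hp0 hp1
    (fun i => (Lbar / Lc i) • (gradient (f i) x - gradient (f i) xstar))
    (fun i => (Lbar / Lc i) • (gradient (f i) (φ i) - gradient (f i) xstar))
  rw [mean, mean, moment, moment, ← hG, Finset.sum_sub_distrib, hstar, sub_zero] at key
  simp only [← smul_sub, sub_sub_sub_cancel_right, ← hν] at key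
  have step (j : Fin n) : p j * ‖xplus j - x‖ ^ 2 = γ ^ 2 * (p j * ‖ν j‖ ^ 2) := by
    rw [hxplus, sub_sub_cancel_left, norm_neg, norm_smul, mul_pow, Real.norm_eq_abs, sq_abs]
    ring
  simp only [step, ← Finset.mul_sum]
  exact (mul_le_mul_of_nonneg_left key (sq_nonneg γ)).trans_eq (by ring)
end

section
/- One-step Lyapunov contraction for SAGA under an arbitrary sampling distribution (key inequality in the proof of Proposition 1(a)): Let E be a real inner product space, let n ≥ 1, and let f_1, …, f_n : E → ℝ each be μ-strongly convex and differentiable with L-Lipschitz continuous gradient, where 0 < μ ≤ L. Let f = (1/n)∑_{i=1}^n f_i with minimizer x*. Let p_1, …, p_n be positive reals with ∑_j p_j = 1 and p_m = min_j p_j. Set η = (4L + nμ)/(n p_m), c = (η² p_m − μη)/2, and define for any x ∈ E and φ : {1,…,n} → E the Lyapunov function T(x, φ) = (1/n)∑_{i=1}^n (1/(n p_i))‖∇f_i(φ_i) − ∇f_i(x*)‖² + c‖x − x*‖². For a sampled index j, define ν_j = (1/(n p_j))(∇f_j(x) − ∇f_j(φ_j)) + (1/n)∑_{i=1}^n ∇f_i(φ_i),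 x⁺_j = x − (1/η) ν_j, and φ⁺(j) to agree with φ except that its j-th entry is replaced by x. Then ∑_{j=1}^n p_j · T(x⁺_j, φ⁺(j)) ≤ (1 − μ/η) · T(x, φ). -/
open scoped BigOperators

section Gradient

variable {E : Type*} [NormedAddCommGroup E] [InnerProductSpace ℝ E] [CompleteSpace E]

theorem hasDerivAt_comp_add_smul_inner_gradient {f : E → ℝ} (hf : Differentiable ℝ f)
    (x v : E) (t : ℝ) :
    HasDerivAt (fun s : ℝ => f (x + s • v)) (inner ℝ (gradient f (x + t • v)) v) t := by
  have hline : HasDerivAt (fun s : ℝ => x + s • v) v t := by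
    simpa using ((hasDerivAt_id t).smul_const v).const_add x
  rw [inner_gradient_left]
  exact (hf _).hasFDerivAt.comp_hasDerivAt t hline

/-- First-order lower bound for a strongly convex differentiable function. -/
theorem add_inner_gradient_add_sq_le_of_strongly_convex {f : E → ℝ} {μ : ℝ}
    (hf : Differentiable ℝ f)
    (hconv : ConvexOn ℝ Set.univ (fun w => f w - μ / 2 * ‖w‖ ^ 2)) (x y : E) :
    f x + inner ℝ (gradient f x) (y - x) + μ / 2 * ‖y - x‖ ^ 2 ≤ f y := by
  have hline := hconv.comp_affineMap (AffineMap.lineMap x y)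
  have hg : ((fun w => f w - μ / 2 * ‖w‖ ^ 2) ∘ AffineMap.lineMap x y) =
      fun t : ℝ => f (x + t • (y - x)) - μ / 2 * ‖x + t • (y - x)‖ ^ 2 := by
    ext t
    simp [AffineMap.lineMap_apply, add_comm]
  rw [hg, Set.preimage_univ] at hline
  have hsq : HasDerivAt (fun t : ℝ => ‖x + t • (y - x)‖ ^ 2) (2 * inner ℝ x (y - x)) 0 := by
    have hl : HasDerivAt (fun s : ℝ => x + s • (y - x)) (y - x) 0 := by
      simpa using ((hasDerivAt_id (0 : ℝ)).smul_const (y - x)).const_add x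
    simpa using hl.norm_sq
  have hder := (hasDerivAt_comp_add_smul_inner_gradient hf x (y - x) 0).sub
    (hsq.const_mul (μ / 2))
  have hslope := hline.le_slope_of_hasDerivAt (Set.mem_univ 0) (Set.mem_univ 1) one_pos hder
  have hexp := norm_sub_sq_real y x
  have hinner : inner ℝ x (y - x) = inner ℝ y x - ‖x‖ ^ 2 := by
    rw [inner_sub_right, real_inner_self_eq_norm_sq, real_inner_comm]
  simp only [slope_def_field, zero_smul, one_smul, add_zero, add_sub_cancel, hinner,
    sub_zero, div_one] at hslope
  rw [hexp]
  linarith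

/-- The descent lemma. -/
theorem le_add_inner_gradient_add_sq_of_lipschitz {f : E → ℝ} {L : ℝ}
    (hf : Differentiable ℝ f)
    (hlip : ∀ w v : E, ‖gradient f w - gradient f v‖ ≤ L * ‖w - v‖) (x y : E) :
    f y ≤ f x + inner ℝ (gradient f x) (y - x) + L / 2 * ‖y - x‖ ^ 2 := by
  set v := y - x with hv
  let ψ : ℝ → ℝ := fun t =>
    f (x + t • v) - t * inner ℝ (gradient f x) v - t ^ 2 * (L / 2 * ‖v‖ ^ 2)
  have hψ (t : ℝ) : HasDerivAt ψ (inner ℝ (gradient f (x + t • v)) v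
      - inner ℝ (gradient f x) v - 2 * t * (L / 2 * ‖v‖ ^ 2)) t := by
    have h1 := (hasDerivAt_id t).mul_const (inner ℝ (gradient f x) v)
    have h2 := (hasDerivAt_pow 2 t).mul_const (L / 2 * ‖v‖ ^ 2)
    exact (((hasDerivAt_comp_add_smul_inner_gradient hf x v t).sub h1).sub h2).congr_deriv (by simp)
  have hanti : AntitoneOn ψ (Set.Icc 0 1) := by
    refine antitoneOn_of_hasDerivWithinAt_nonpos (convex_Icc 0 1)
      (fun t _ => (hψ t).continuousAt.continuousWithinAt)
      (fun t _ => (hψ t).hasDerivWithinAt) fun t ht => ?_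
    have ht0 : 0 ≤ t := (interior_subset ht).1
    have hgrad := hlip (x + t • v) x
    rw [add_sub_cancel_left, norm_smul, Real.norm_of_nonneg ht0] at hgrad
    have hcs := real_inner_le_norm (gradient f (x + t • v) - gradient f x) v
    have hmul := mul_le_mul_of_nonneg_right hgrad (norm_nonneg v)
    rw [inner_sub_left] at hcs
    linarith
  have h := hanti (Set.left_mem_Icc.2 zero_le_one) (Set.right_mem_Icc.2 zero_le_one) zero_le_one
  simp only [ψ, hv, one_smul, zero_smul, add_sub_cancel, add_zero] at h
  linarith

/-- Strong convexity makes the gradient strongly monotone. -/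
theorem mul_sq_le_inner_gradient_sub_of_strongly_convex {f : E → ℝ} {μ : ℝ}
    (hf : Differentiable ℝ f)
    (hconv : ConvexOn ℝ Set.univ (fun w => f w - μ / 2 * ‖w‖ ^ 2)) (x y : E) :
    μ * ‖x - y‖ ^ 2 ≤ inner ℝ (x - y) (gradient f x - gradient f y) := by
  have h1 := add_inner_gradient_add_sq_le_of_strongly_convex hf hconv x y
  have h2 := add_inner_gradient_add_sq_le_of_strongly_convex hf hconv y x
  rw [← neg_sub x y, inner_neg_right, norm_neg] at h1
  rw [real_inner_comm, inner_sub_left]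
  linarith

/-- Cocoercivity (Baillon–Haddad) of the Lipschitz gradient of a function bounded below by its
tangent planes. -/
theorem sq_norm_gradient_sub_le_mul_inner {f : E → ℝ} {L : ℝ} (hL : 0 < L)
    (hf : Differentiable ℝ f)
    (htangent : ∀ x y, f x + inner ℝ (gradient f x) (y - x) ≤ f y)
    (hlip : ∀ w v : E, ‖gradient f w - gradient f v‖ ≤ L * ‖w - v‖) (x y : E) :
    ‖gradient f x - gradient f y‖ ^ 2 ≤ L * inner ℝ (x - y) (gradient f x - gradient f y) := by
  have key (x y : E) : f y + inner ℝ (gradient f y) (x - y)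
      + (2 * L)⁻¹ * ‖gradient f x - gradient f y‖ ^ 2 ≤ f x := by
    set D := gradient f x - gradient f y with hD
    have hlow := htangent y (x - L⁻¹ • D)
    have hupp := le_add_inner_gradient_add_sq_of_lipschitz hf hlip x (x - L⁻¹ • D)
    have hDD : inner ℝ (gradient f x) D - inner ℝ (gradient f y) D = ‖D‖ ^ 2 := by
      rw [← inner_sub_left, ← hD, real_inner_self_eq_norm_sq]
    rw [sub_right_comm, inner_sub_right, real_inner_smul_right] at hlow
    rw [sub_sub_cancel_left, inner_neg_right, real_inner_smul_right, norm_neg, norm_smul,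
      mul_pow, Real.norm_of_nonneg (inv_nonneg.2 hL.le)] at hupp
    have hcoef : L / 2 * (L⁻¹ ^ 2 * ‖D‖ ^ 2) = (2 * L)⁻¹ * ‖D‖ ^ 2 := by field_simp
    have hcoef' : L⁻¹ * ‖D‖ ^ 2 = 2 * ((2 * L)⁻¹ * ‖D‖ ^ 2) := by field_simp
    have hmul : L⁻¹ * inner ℝ (gradient f x) D - L⁻¹ * inner ℝ (gradient f y) D
        = L⁻¹ * ‖D‖ ^ 2 := by rw [← mul_sub, hDD]
    linarith
  have h1 := key x y
  have h2 := key y x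
  rw [← neg_sub x y, inner_neg_right, norm_sub_rev] at h2
  have hsum : L⁻¹ * ‖gradient f x - gradient f y‖ ^ 2 ≤
      inner ℝ (x - y) (gradient f x - gradient f y) := by
    rw [real_inner_comm, inner_sub_left]
    have : L⁻¹ * ‖gradient f x - gradient f y‖ ^ 2 =
      2 * ((2 * L)⁻¹ * ‖gradient f x - gradient f y‖ ^ 2) := by field_simp
    linarith
  rwa [inv_mul_le_iff₀ hL] at hsum

theorem sum_gradient_eq_zero_of_forall_le {ι : Type*} [Fintype ι] {f : ι → E → ℝ}
    (hf : ∀ i, Differentiable ℝ (f i)) {x : E}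
    (hmin : ∀ w, ∑ i, f i x ≤ ∑ i, f i w) : ∑ i, gradient (f i) x = 0 := by
  have hder : HasFDerivAt (fun w => ∑ i, f i w) (∑ i, fderiv ℝ (f i) x) x :=
    HasFDerivAt.fun_sum fun i _ => (hf i x).hasFDerivAt
  have hloc : IsLocalMin (fun w => ∑ i, f i w) x := Filter.Eventually.of_forall hmin
  have hzero := hloc.hasFDerivAt_eq_zero hder
  simp only [gradient, ← map_sum, hzero, map_zero]

end Gradient

section Sampling

variable {E : Type*} [NormedAddCommGroup E] [InnerProductSpace ℝ E] {ι : Type*} [Fintype ι]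

/-- Expansion of a weighted second moment around an arbitrary point. -/
theorem sum_mul_sq_norm_sub_smul {p : ι → ℝ} (hp : ∑ j, p j = 1) (d : E) (s : ℝ) (w : ι → E) :
    ∑ j, p j * ‖d - s • w j‖ ^ 2 =
      ‖d‖ ^ 2 - 2 * s * inner ℝ d (∑ j, p j • w j) + s ^ 2 * ∑ j, p j * ‖w j‖ ^ 2 := by
  have hterm (j : ι) : p j * ‖d - s • w j‖ ^ 2 =
      p j * ‖d‖ ^ 2 - 2 * s * inner ℝ d (p j • w j) + s ^ 2 * (p j * ‖w j‖ ^ 2) := by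
    rw [norm_sub_sq_real, real_inner_smul_right, real_inner_smul_right, norm_smul, mul_pow,
      Real.norm_eq_abs, sq_abs]
    ring
  simp only [hterm, Finset.sum_add_distrib, Finset.sum_sub_distrib, ← Finset.mul_sum,
    ← Finset.sum_mul, hp, inner_sum, one_mul]

theorem sum_mul_sq_norm_mean_sub_le {p : ι → ℝ} (hp : ∑ j, p j = 1) (w : ι → E) :
    ∑ j, p j * ‖∑ i, p i • w i - w j‖ ^ 2 ≤ ∑ j, p j * ‖w j‖ ^ 2 := by
  have h := sum_mul_sq_norm_sub_smul hp (∑ i, p i • w i) 1 w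
  simp only [one_smul, real_inner_self_eq_norm_sq] at h
  rw [h]
  linarith [sq_nonneg ‖∑ i, p i • w i‖]

/-- Second-moment bound for the SAGA direction, with `u` and `w` the reweighted current and
stored gradients. -/
theorem sum_mul_sq_norm_sub_add_mean_le {p : ι → ℝ} (hp0 : ∀ j, 0 ≤ p j) (hp : ∑ j, p j = 1)
    (u w : ι → E) :
    ∑ j, p j * ‖u j - w j + ∑ i, p i • w i‖ ^ 2 ≤
      2 * ∑ j, p j * ‖u j‖ ^ 2 + 2 * ∑ j, p j * ‖w j‖ ^ 2 := by
  have hterm (j : ι) : p j * ‖u j - w j + ∑ i, p i • w i‖ ^ 2 ≤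
      2 * (p j * ‖u j‖ ^ 2) + 2 * (p j * ‖∑ i, p i • w i - w j‖ ^ 2) := by
    have hrw : u j - w j + ∑ i, p i • w i = u j + (∑ i, p i • w i - w j) := by abel
    have hpar := parallelogram_law_with_norm ℝ (u j) (∑ i, p i • w i - w j)
    have hle : ‖u j + (∑ i, p i • w i - w j)‖ ^ 2 ≤
        2 * ‖u j‖ ^ 2 + 2 * ‖∑ i, p i • w i - w j‖ ^ 2 := by
      nlinarith [norm_nonneg (u j - (∑ i, p i • w i - w j))]
    rw [hrw]
    linarith [mul_le_mul_of_nonneg_left hle (hp0 j)]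
  calc _ ≤ ∑ j, (2 * (p j * ‖u j‖ ^ 2) + 2 * (p j * ‖∑ i, p i • w i - w j‖ ^ 2)) :=
        Finset.sum_le_sum fun j _ => hterm j
    _ ≤ _ := by
        rw [Finset.sum_add_distrib, ← Finset.mul_sum, ← Finset.mul_sum]
        linarith [sum_mul_sq_norm_mean_sub_le hp w]

theorem sum_mul_sum_update [DecidableEq ι] {M : Type*} {p : ι → ℝ} (hp : ∑ j, p j = 1)
    (F : ι → M → ℝ) (x : M) (φ : ι → M) :
    ∑ j, p j * ∑ i, F i (Function.update φ j x i) =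
      ∑ i, F i (φ i) + ∑ j, p j * (F j x - F j (φ j)) := by
  have hterm (j : ι) : ∑ i, F i (Function.update φ j x i) =
      ∑ i, F i (φ i) + (F j x - F j (φ j)) := by
    rw [← sub_eq_iff_eq_add', ← Finset.sum_sub_distrib,
      Finset.sum_eq_single j (by intro i _ hi; simp [hi]) (by simp)]
    simp
  simp only [hterm, mul_add, Finset.sum_add_distrib, ← Finset.sum_mul, hp, one_mul]

end Sampling

/-- One-step Lyapunov contraction for SAGA under an arbitrary sampling
distribution (key inequality in the proof of Proposition 1(a)). -/
theorem saga_nus_one_step_contraction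
    {E : Type*} [NormedAddCommGroup E] [InnerProductSpace ℝ E] [CompleteSpace E]
    {n : ℕ} (hn : 1 ≤ n)
    (f : Fin n → E → ℝ) (μ L : ℝ) (hμ : 0 < μ) (hμL : μ ≤ L)
    (hdiff : ∀ i, Differentiable ℝ (f i))
    (hsc : ∀ i, ConvexOn ℝ Set.univ (fun w => f i w - μ / 2 * ‖w‖ ^ 2))
    (hlip : ∀ i, ∀ w v : E, ‖gradient (f i) w - gradient (f i) v‖ ≤ L * ‖w - v‖)
    (fbar : E → ℝ) (hfbar : fbar = fun w => (1 / n : ℝ) * ∑ i, f i w)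
    (xstar : E) (hmin : ∀ w, fbar xstar ≤ fbar w)
    (p : Fin n → ℝ) (hp : ∀ j, 0 < p j) (hps : ∑ j, p j = 1)
    (pm : ℝ) (hpm_le : ∀ j, pm ≤ p j) (hpm_mem : ∃ j, p j = pm)
    (η : ℝ) (hη : η = (4 * L + n * μ) / (n * pm))
    (c : ℝ) (hc : c = (η ^ 2 * pm - μ * η) / 2)
    (T : E → (Fin n → E) → ℝ)
    (hT : ∀ z ψ, T z ψ =
      (1 / n : ℝ) * ∑ i, (1 / (n * p i)) * ‖gradient (f i) (ψ i) - gradient (f i) xstar‖ ^ 2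
        + c * ‖z - xstar‖ ^ 2)
    (x : E) (φ : Fin n → E)
    (ν : Fin n → E)
    (hν : ∀ j, ν j = (1 / (n * p j)) • (gradient (f j) x - gradient (f j) (φ j))
        + (1 / n : ℝ) • ∑ i, gradient (f i) (φ i))
    (xplus : Fin n → E) (hxplus : ∀ j, xplus j = x - (1 / η) • ν j)
    (φplus : Fin n → Fin n → E) (hφplus : ∀ j, φplus j = Function.update φ j x) :
    ∑ j, p j * T (xplus j) (φplus j) ≤ (1 - μ / η) * T x φ := by
  classical
  have hn0 : (0 : ℝ) < n := by exact_mod_cast hn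
  have hL : 0 < L := hμ.trans_le hμL
  have hpm : 0 < pm := by
    obtain ⟨j, rfl⟩ := hpm_mem
    exact hp j
  have hη0 : 0 < η := by rw [hη]; positivity
  have hηpm : η * pm = 4 * L / n + μ := by rw [hη]; field_simp
  have hgrad0 : ∑ i, gradient (f i) xstar = 0 := by
    refine sum_gradient_eq_zero_of_forall_le hdiff fun w => ?_
    have h := hmin w
    rw [hfbar] at h
    exact le_of_mul_le_mul_left h (by positivity)
  set d := x - xstar with hd
  set a : Fin n → E := fun i => gradient (f i) x - gradient (f i) xstar with ha
  set b : Fin n → E := fun i => gradient (f i) (φ i) - gradient (f i) xstar with hb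
  set u : Fin n → E := fun i => (1 / (n * p i)) • a i with hu
  set w : Fin n → E := fun i => (1 / (n * p i)) • b i with hw
  have hscale (i : Fin n) (v : E) : p i • (1 / (n * p i)) • v = (1 / n : ℝ) • v := by
    have := (hp i).ne'
    rw [smul_smul]
    congr 1
    field_simp
  have hsq (i : Fin n) (v : E) : p i * ‖(1 / (n * p i)) • v‖ ^ 2 =
      (1 / n : ℝ) * ((1 / (n * p i)) * ‖v‖ ^ 2) := by
    have := (hp i).ne'
    rw [norm_smul, mul_pow, Real.norm_eq_abs, sq_abs]
    field_simp
  have hν' (j : Fin n) : ν j = u j - w j + ∑ i, p i • w i := by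
    simp only [hν, hu, hw, ha, hb, hscale, ← Finset.smul_sum, Finset.sum_sub_distrib, hgrad0,
      sub_zero, ← smul_sub, sub_sub_sub_cancel_right]
  have hmean : ∑ j, p j • ν j = (1 / n : ℝ) • ∑ i, a i := by
    simp only [hν', smul_add, smul_sub, Finset.sum_add_distrib, Finset.sum_sub_distrib,
      ← Finset.sum_smul, hps, one_smul, sub_add_cancel, hu, hscale, ← Finset.smul_sum]
  set D := ‖d‖ ^ 2 with hD
  set I := inner ℝ d ((1 / n : ℝ) • ∑ i, a i) with hI
  set M := ∑ j, p j * ‖ν j‖ ^ 2 with hM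
  set Sa := ∑ j, p j * ‖u j‖ ^ 2 with hSa
  set Sb := ∑ j, p j * ‖w j‖ ^ 2 with hSb
  have hI' : I = (1 / n : ℝ) * ∑ i, inner ℝ d (a i) := by
    rw [hI, real_inner_smul_right, inner_sum]
  have hMle : M ≤ 2 * Sa + 2 * Sb := by
    rw [hM]
    simp only [hν']
    exact sum_mul_sq_norm_sub_add_mean_le (fun j => (hp j).le) hps u w
  have hSa0 : 0 ≤ Sa := Finset.sum_nonneg fun j _ => mul_nonneg (hp j).le (sq_nonneg _)
  have hmin_weight (v : Fin n → E) : pm * ∑ j, p j * ‖(1 / (n * p j)) • v j‖ ^ 2 ≤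
      (1 / n : ℝ) * ((1 / n : ℝ) * ∑ j, ‖v j‖ ^ 2) := by
    simp only [Finset.mul_sum]
    refine Finset.sum_le_sum fun j _ => ?_
    have hpj := hp j
    calc pm * (p j * ‖(1 / (n * p j)) • v j‖ ^ 2)
        ≤ p j * (p j * ‖(1 / (n * p j)) • v j‖ ^ 2) :=
          mul_le_mul_of_nonneg_right (hpm_le j) (by positivity)
      _ = (1 / n : ℝ) * ((1 / n : ℝ) * ‖v j‖ ^ 2) := by
          rw [hsq]
          field_simp
  have hSa_le : pm * Sa ≤ (1 / n : ℝ) * ((1 / n : ℝ) * ∑ j, ‖a j‖ ^ 2) := hmin_weight a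
  have hSb_le : pm * Sb ≤ (1 / n : ℝ) * ((1 / n : ℝ) * ∑ j, ‖b j‖ ^ 2) := hmin_weight b
  have hstrong : μ * D ≤ I := by
    have h : ∑ _i : Fin n, μ * D ≤ ∑ i, inner ℝ d (a i) := Finset.sum_le_sum fun i _ =>
      mul_sq_le_inner_gradient_sub_of_strongly_convex (hdiff i) (hsc i) x xstar
    rw [Finset.sum_const, Finset.card_univ, Fintype.card_fin, nsmul_eq_mul] at h
    rw [hI', one_div, le_inv_mul_iff₀ hn0]
    exact h
  have hcoco : (1 / n : ℝ) * ∑ j, ‖a j‖ ^ 2 ≤ L * I := by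
    rw [hI', mul_left_comm, Finset.mul_sum Finset.univ _ L]
    refine mul_le_mul_of_nonneg_left (Finset.sum_le_sum fun i _ => ?_)
      (one_div_nonneg.2 hn0.le)
    refine sq_norm_gradient_sub_le_mul_inner hL (hdiff i) (fun y z => ?_) (hlip i) x xstar
    have h := add_inner_gradient_add_sq_le_of_strongly_convex (hdiff i) (hsc i) y z
    have : 0 ≤ μ / 2 * ‖z - y‖ ^ 2 := by positivity
    linarith
  have hTx : T x φ = Sb + c * D := by
    rw [hT, hSb]
    simp only [hw, hsq, ← Finset.mul_sum, hb, hD, hd]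
  have hdist : ∑ j, p j * ‖xplus j - xstar‖ ^ 2 = D - 2 * (1 / η) * I + (1 / η) ^ 2 * M := by
    rw [hD, hI, hM, ← hmean, ← sum_mul_sq_norm_sub_smul hps d (1 / η) ν]
    simp only [hxplus, hd, sub_right_comm]
  have hmem : ∑ j, p j * ∑ i, (1 / (n * p i)) *
        ‖gradient (f i) (Function.update φ j x i) - gradient (f i) xstar‖ ^ 2 =
      n * Sb + (1 / n : ℝ) * (∑ j, ‖a j‖ ^ 2 - ∑ j, ‖b j‖ ^ 2) := by
    rw [sum_mul_sum_update hps
      (fun i z => (1 / (n * p i)) * ‖gradient (f i) z - gradient (f i) xstar‖ ^ 2) x φ]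
    congr 1
    · simp only [hSb, hw, hsq, ← Finset.mul_sum, hb]
      field_simp
    · rw [← Finset.sum_sub_distrib, Finset.mul_sum]
      refine Finset.sum_congr rfl fun j _ => ?_
      have := (hp j).ne'
      simp only [ha, hb]
      field_simp
  have hTplus : ∑ j, p j * T (xplus j) (φplus j) =
      Sb + (1 / n : ℝ) * ((1 / n : ℝ) * (∑ j, ‖a j‖ ^ 2 - ∑ j, ‖b j‖ ^ 2))
        + c * (D - 2 * (1 / η) * I + (1 / η) ^ 2 * M) := by
    simp only [hT, hφplus, mul_add, Finset.sum_add_distrib, mul_left_comm (p _),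
      ← Finset.mul_sum]
    rw [hmem, hdist]
    field_simp
  have hcη : c * (1 / η) = 2 * L / n := by
    have : c * (1 / η) = (η * pm - μ) / 2 := by rw [hc]; field_simp
    rw [this, hηpm]
    ring
  have hcη2 : c * (1 / η) ^ 2 = (pm - μ / η) / 2 := by rw [hc]; field_simp
  have hκ : 0 ≤ pm - μ / η := by
    rw [sub_nonneg, div_le_iff₀ hη0, mul_comm, hηpm]
    linarith [show 0 ≤ 4 * L / n by positivity]
  have hκM := mul_le_mul_of_nonneg_left hMle hκ
  have hμSa : 0 ≤ μ / η * Sa := by positivity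
  have hcocon := mul_le_mul_of_nonneg_left hcoco (show (0 : ℝ) ≤ 1 / n by positivity)
  have hstrongn := mul_le_mul_of_nonneg_left hstrong (show 0 ≤ 2 * L / n by positivity)
  have hdistc : c * (D - 2 * (1 / η) * I + (1 / η) ^ 2 * M) =
      c * D - 2 * (2 * L / n) * I + (pm - μ / η) / 2 * M := by
    rw [← hcη, ← hcη2]
    ring
  have hrhs : (1 - μ / η) * (Sb + c * D) =
      Sb + c * D - μ / η * Sb - 2 * L / n * (μ * D) := by
    rw [← hcη]
    ring
  have hLI : (1 / n : ℝ) * (L * I) = 2 * L / n * I / 2 := by ring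
  rw [hTplus, hTx, hdistc, hrhs]
  linarith
end

section
/- Proposition 1(b) (linear convergence of SAGA with Lipschitz sampling, with rate depending on the average Lipschitz constant): Let E be a real inner product space, let n ≥ 1, and let f_1, …, f_n : E → ℝ be convex and differentiable with ∇f_i Lipschitz continuous with constant L_i > 0. Suppose f = (1/n)∑_{i=1}^n f_i is μ-strongly convex with 0 < μ ≤ L̄, where L̄ = (1/n)∑_i L_i, and let x* be the minimizer of f. Set α = 1/(4L̄) and p_j = L_j/(∑_{i=1}^n L_i). Starting from x⁰ ∈ E and φ⁰_i = x⁰ for all i, run the recursion: at each step t, sample j_t = j with probability p_j and independently sample r_t uniformly from {1,…,n}; set x^{t+1} = x^t − α[ (L̄/L_{j_t})(∇f_{j_t}(x^t) − ∇f_{j_t}(φ^t_{j_t})) + (1/n)∑_{i=1}^n ∇f_i(φ^t_i) ], and update φ^{t+1}_{r_t} = x^t while φ^{t+1}_j = φ^t_j for j ≠ r_t. Then for every t ≥ 0, the expectation over all length-t sequences of pairs (j_k, r_k) (weighted by ∏_{k<t} p_{j_k}·(1/n)) satisfies E[‖x^t − x*‖²] ≤ (1 − min{1/(3n), μ/(8L̄)})^t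 [ ‖x⁰ − x*‖² + C_b ], where C_b = (n/(2L̄))(f(x⁰) − f(x*)). -/
open scoped BigOperators

section ConvexSmooth

/-- A convex function lies above its tangent hyperplanes. -/
theorem ConvexOn.add_hasFDerivAt_sub_le {E : Type*} [NormedAddCommGroup E] [NormedSpace ℝ E]
    {f : E → ℝ} {f' : E →L[ℝ] ℝ} {x : E} (hf : ConvexOn ℝ Set.univ f) (hf' : HasFDerivAt f f' x)
    (y : E) : f x + f' (y - x) ≤ f y := by
  have hconv : ConvexOn ℝ Set.univ (f ∘ AffineMap.lineMap (k := ℝ) x y) := by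
    simpa using hf.comp_affineMap (AffineMap.lineMap (k := ℝ) x y)
  have hderiv : HasDerivAt (f ∘ AffineMap.lineMap (k := ℝ) x y) (f' (y - x)) 0 := by
    have hx : HasFDerivAt f f' (AffineMap.lineMap x y (0 : ℝ)) := by simpa using hf'
    exact hx.comp_hasDerivAt 0 AffineMap.hasDerivAt_lineMap
  have h := hconv.le_slope_of_hasDerivAt (Set.mem_univ 0) (Set.mem_univ 1) one_pos hderiv
  simp [slope_def_field] at h
  rw [map_sub]
  linarith

variable {E : Type*} [NormedAddCommGroup E] [InnerProductSpace ℝ E] [CompleteSpace E]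

/-- A convex function lies above its tangent hyperplanes, in terms of the gradient. -/
theorem ConvexOn.add_inner_gradient_le {f : E → ℝ} {x : E} (hf : ConvexOn ℝ Set.univ f)
    (hd : DifferentiableAt ℝ f x) (y : E) : f x + inner ℝ (gradient f x) (y - x) ≤ f y := by
  have h := hf.add_hasFDerivAt_sub_le hd.hasGradientAt.hasFDerivAt y
  rwa [InnerProductSpace.toDual_apply_apply] at h

/-- First order lower bound for a strongly convex function. -/
theorem ConvexOn.add_inner_add_sq_le {f : E → ℝ} {g x : E} {μ : ℝ}
    (hf : ConvexOn ℝ Set.univ fun w => f w - μ / 2 * ‖w‖ ^ 2) (hg : HasGradientAt f g x) (y : E) :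
    f x + inner ℝ g (y - x) + μ / 2 * ‖y - x‖ ^ 2 ≤ f y := by
  have h := hf.add_hasFDerivAt_sub_le
    (hg.hasFDerivAt.sub (((hasFDerivAt_id x).norm_sq).const_mul (μ / 2))) y
  have hsq : ‖y - x‖ ^ 2 = ‖y‖ ^ 2 - 2 * inner ℝ x y + ‖x‖ ^ 2 := by
    rw [norm_sub_sq_real, real_inner_comm]
  simp [inner_sub_right] at h
  rw [hsq, inner_sub_right]
  linarith

/-- The descent lemma: quadratic upper bound for a function with Lipschitz gradient. -/
theorem le_add_inner_gradient_add_sq {f : E → ℝ} {L : ℝ} (hd : Differentiable ℝ f)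
    (hlip : ∀ w v : E, ‖gradient f w - gradient f v‖ ≤ L * ‖w - v‖) (x y : E) :
    f y ≤ f x + inner ℝ (gradient f x) (y - x) + L / 2 * ‖y - x‖ ^ 2 := by
  set d := y - x with hdef
  let h : ℝ → ℝ := fun t => f (x + t • d) - t * inner ℝ (gradient f x) d - L / 2 * t ^ 2 * ‖d‖ ^ 2
  have hderiv (t : ℝ) : HasDerivAt h (inner ℝ (gradient f (x + t • d)) d
      - inner ℝ (gradient f x) d - L * t * ‖d‖ ^ 2) t := by
    have hline : HasDerivAt (fun t : ℝ => x + t • d) d t := by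
      simpa using ((hasDerivAt_id t).smul_const d).const_add x
    have h1 := (hd (x + t • d)).hasGradientAt.hasFDerivAt.comp_hasDerivAt t hline
    rw [InnerProductSpace.toDual_apply_apply] at h1
    have h2 := (hasDerivAt_id t).mul_const (inner ℝ (gradient f x) d)
    have h3 := (((hasDerivAt_id t).pow 2).const_mul (L / 2)).mul_const (‖d‖ ^ 2)
    refine ((h1.sub h2).sub h3).congr_deriv ?_
    simp only [id_eq, Nat.cast_ofNat]
    ring
  have hanti : AntitoneOn h (Set.Icc 0 1) := by
    refine antitoneOn_of_deriv_nonpos (convex_Icc 0 1)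
      (fun t _ => (hderiv t).continuousAt.continuousWithinAt)
      (fun t _ => (hderiv t).differentiableAt.differentiableWithinAt) fun t ht => ?_
    rw [interior_Icc] at ht
    rw [(hderiv t).deriv, ← inner_sub_left]
    have h1 := real_inner_le_norm (gradient f (x + t • d) - gradient f x) d
    have h2 := hlip (x + t • d) x
    rw [add_sub_cancel_left, norm_smul, Real.norm_eq_abs, abs_of_pos ht.1] at h2
    nlinarith [norm_nonneg d]
  have h01 := hanti (Set.left_mem_Icc.2 zero_le_one) (Set.right_mem_Icc.2 zero_le_one) zero_le_one
  simp only [h, zero_smul, one_smul, add_zero] at h01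
  rw [hdef, add_sub_cancel, ← hdef] at h01
  linarith

/-- Improved first order lower bound for a convex function with Lipschitz gradient. -/
theorem ConvexOn.add_inner_gradient_add_sq_le {f : E → ℝ} {L : ℝ} (hL : 0 < L)
    (hf : ConvexOn ℝ Set.univ f) (hd : Differentiable ℝ f)
    (hlip : ∀ w v : E, ‖gradient f w - gradient f v‖ ≤ L * ‖w - v‖) (x y : E) :
    f x + inner ℝ (gradient f x) (y - x) + ‖gradient f y - gradient f x‖ ^ 2 / L / 2 ≤ f y := by
  set g := gradient f y - gradient f x with hg
  have h1 := le_add_inner_gradient_add_sq hd hlip y (y - L⁻¹ • g)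
  have h2 := hf.add_inner_gradient_le (hd x) (y - L⁻¹ • g)
  have h3 : inner ℝ (gradient f y) g - inner ℝ (gradient f x) g = ‖g‖ ^ 2 := by
    rw [← inner_sub_left, ← hg, real_inner_self_eq_norm_sq]
  rw [sub_sub_cancel_left, inner_neg_right, real_inner_smul_right, norm_neg, norm_smul,
    Real.norm_eq_abs, abs_of_pos (inv_pos.2 hL)] at h1
  rw [sub_right_comm, inner_sub_right, real_inner_smul_right] at h2
  have h4 : L / 2 * (L⁻¹ * ‖g‖) ^ 2 = ‖g‖ ^ 2 / L / 2 := by field_simp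
  have h5 : L⁻¹ * inner ℝ (gradient f y) g - L⁻¹ * inner ℝ (gradient f x) g = ‖g‖ ^ 2 / L := by
    rw [← mul_sub, h3]; field_simp
  linarith

end ConvexSmooth

section Sampling

/-- Expected squared distance after a variance-reduced step: `A j - B j + ∑ k, w k • B k` estimates
`∑ k, w k • A k`. -/
theorem sum_norm_sub_smul_estimator_sq_le {E ι : Type*} [NormedAddCommGroup E]
    [InnerProductSpace ℝ E] [Fintype ι] (w : ι → ℝ) (hw : ∀ j, 0 ≤ w j) (hw1 : ∑ j, w j = 1)
    (A B : ι → E) (d : E) (α : ℝ) :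
    ∑ j, w j * ‖d - α • (A j - B j + ∑ k, w k • B k)‖ ^ 2 ≤
      ‖d‖ ^ 2 - 2 * α * inner ℝ (∑ j, w j • A j) d
        + 2 * α ^ 2 * (∑ j, w j * ‖A j‖ ^ 2 + ∑ j, w j * ‖B j‖ ^ 2) := by
  set b := ∑ k, w k • B k with hb
  have hpt (j : ι) : ‖d - α • (A j - B j + b)‖ ^ 2 ≤
      (‖d‖ ^ 2 - 2 * α * inner ℝ b d + 2 * α ^ 2 * ‖b‖ ^ 2) - 2 * α * inner ℝ (A j) d
        + 2 * α * inner ℝ (B j) d + 2 * α ^ 2 * ‖A j‖ ^ 2 + 2 * α ^ 2 * ‖B j‖ ^ 2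
        - 4 * α ^ 2 * inner ℝ (B j) b := by
    have h1 : ‖A j - B j + b‖ ^ 2 ≤ 2 * ‖A j‖ ^ 2 + 2 * ‖B j - b‖ ^ 2 := by
      have h2 := parallelogram_law_with_norm ℝ (A j) (B j - b)
      rw [show A j - (B j - b) = A j - B j + b by abel] at h2
      nlinarith [mul_self_nonneg ‖A j + (B j - b)‖]
    rw [norm_sub_sq_real (B j)] at h1
    rw [norm_sub_sq_real, norm_smul, mul_pow, Real.norm_eq_abs, sq_abs, real_inner_smul_right,
      real_inner_comm, inner_add_left, inner_sub_left]
    nlinarith [mul_le_mul_of_nonneg_left h1 (sq_nonneg α)]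
  have hin (v : E) (C : ι → E) : ∑ j, w j * inner ℝ (C j) v = inner ℝ (∑ j, w j • C j) v := by
    simp [sum_inner, real_inner_smul_left]
  have hsum := Finset.sum_le_sum fun j (_ : j ∈ Finset.univ) =>
    mul_le_mul_of_nonneg_left (hpt j) (hw j)
  refine hsum.trans ?_
  simp only [mul_add, mul_sub, Finset.sum_add_distrib, Finset.sum_sub_distrib,
    mul_left_comm (w _), ← Finset.mul_sum, ← Finset.sum_mul, hw1, hin d A, hin d B, hin b B, ← hb,
    real_inner_self_eq_norm_sq]
  nlinarith [mul_nonneg (sq_nonneg α) (sq_nonneg ‖b‖)]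

/-- A function of sampled paths that contracts in conditional expectation decays geometrically. -/
theorem sum_prod_mul_le_pow_mul {S : Type*} [Fintype S] (w : S → ℝ) (hw : ∀ a, 0 ≤ w a)
    {ρ : ℝ} (hρ : 0 ≤ ρ) (V : (t : ℕ) → (Fin t → S) → ℝ)
    (hV : ∀ (t : ℕ) (σ : Fin t → S),
      ∑ a, w a * V (t + 1) (Fin.snoc (α := fun _ => S) σ a) ≤ ρ * V t σ) (t : ℕ) :
    ∑ σ : Fin t → S, (∏ k, w (σ k)) * V t σ ≤ ρ ^ t * V 0 Fin.elim0 := by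
  induction t with
  | zero => simp [Subsingleton.elim (default : Fin 0 → S) Fin.elim0]
  | succ t ih =>
    calc ∑ σ : Fin (t + 1) → S, (∏ k, w (σ k)) * V (t + 1) σ
        = ∑ σ : Fin t → S, (∏ k, w (σ k)) *
            ∑ a, w a * V (t + 1) (Fin.snoc (α := fun _ => S) σ a) := by
          rw [← (Fin.snocEquiv fun _ => S).sum_comp, Fintype.sum_prod_type_right]
          simp [Fin.snocEquiv, Fin.prod_univ_castSucc, Finset.mul_sum, mul_assoc]
      _ ≤ ∑ σ : Fin t → S, (∏ k, w (σ k)) * (ρ * V t σ) :=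
          Finset.sum_le_sum fun σ _ => mul_le_mul_of_nonneg_left (hV t σ)
            (Finset.prod_nonneg fun k _ => hw _)
      _ = ρ * ∑ σ : Fin t → S, (∏ k, w (σ k)) * V t σ := by
          simp [Finset.mul_sum, mul_left_comm]
      _ ≤ ρ ^ (t + 1) * V 0 Fin.elim0 := by
          rw [pow_succ', mul_assoc]
          exact mul_le_mul_of_nonneg_left ih hρ

/-- Sum of the effect of updating one entry chosen in all possible ways. -/
theorem sum_sum_apply_update {ι E : Type*} [Fintype ι] [DecidableEq ι] (D : ι → E → ℝ) (φ : ι → E)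
    (x : E) : ∑ r, ∑ i, D i (Function.update φ r x i) =
      Fintype.card ι * ∑ i, D i (φ i) + ∑ i, D i x - ∑ i, D i (φ i) := by
  have h (r : ι) : ∑ i, D i (Function.update φ r x i) = ∑ i, D i (φ i) + (D r x - D r (φ r)) := by
    rw [← sub_eq_iff_eq_add', ← Finset.sum_sub_distrib, Finset.sum_eq_single r]
    · simp
    · intro i _ hi
      simp [hi]
    · simp
  simp [h, Finset.sum_add_distrib, Finset.sum_sub_distrib]
  ring

end Sampling

section SagaStep

variable {E : Type*} [NormedAddCommGroup E] [InnerProductSpace ℝ E]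

/-- The Lyapunov function of SAGA with Lipschitz sampling; `D i` is meant to be the Bregman
distance of the `i`-th summand from the minimizer. -/
noncomputable def sagaLyapunov {n : ℕ} (D : Fin n → E → ℝ) (Lbar : ℝ) (xstar x : E)
    (φ : Fin n → E) : ℝ :=
  ‖x - xstar‖ ^ 2 + 1 / (2 * Lbar) * ∑ i, D i (φ i)

/-- One step of SAGA with Lipschitz sampling: contraction of the Lyapunov function, given the
first order inequalities relating the gradients `G` at `x`, `H` at the stored points and `S` at the
minimizer. -/
theorem saga_lyapunov_step {n : ℕ} (hn : 1 ≤ n) (Lc : Fin n → ℝ) (hL : ∀ i, 0 < Lc i)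
    {Lbar : ℝ} (hLbar : Lbar = (1 / n : ℝ) * ∑ i, Lc i) {μ : ℝ}
    (D : Fin n → E → ℝ) (xstar x : E) (φ G H S : Fin n → E) (hS : ∑ i, S i = 0)
    (hH : ∀ i, ‖H i - S i‖ ^ 2 / Lc i / 2 ≤ D i (φ i))
    (hG : ∀ i, D i x + ‖G i - S i‖ ^ 2 / Lc i / 2 ≤ inner ℝ (G i - S i) (x - xstar))
    (hsc : ∑ i, D i x + n * (μ / 2 * ‖x - xstar‖ ^ 2) ≤ inner ℝ (∑ i, G i) (x - xstar)) :
    ∑ a : Fin n × Fin n, (Lc a.1 / ∑ i, Lc i) * (1 / n : ℝ) *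
        sagaLyapunov D Lbar xstar
          (x - (1 / (4 * Lbar)) • ((Lbar / Lc a.1) • (G a.1 - H a.1) + (1 / n : ℝ) • ∑ i, H i))
          (Function.update φ a.2 x) ≤
      (1 - min (1 / (3 * (n : ℝ))) (μ / (8 * Lbar))) * sagaLyapunov D Lbar xstar x φ := by
  have hn0 : (0 : ℝ) < n := by exact_mod_cast hn
  have : Nonempty (Fin n) := ⟨⟨0, hn⟩⟩
  have hsum : 0 < ∑ i, Lc i := Finset.sum_pos (fun i _ => hL i) Finset.univ_nonempty
  have hsumL : ∑ i, Lc i = n * Lbar := by rw [hLbar]; field_simp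
  have hLb : 0 < Lbar := by rw [hLbar]; positivity
  set w : Fin n → ℝ := fun j => Lc j / ∑ i, Lc i with hw
  have hw1 : ∑ j, w j = 1 := by rw [hw, ← Finset.sum_div, div_self hsum.ne']
  have hwL (j : Fin n) : w j * (Lbar / Lc j) = 1 / n := by
    have := (hL j).ne'
    simp only [hw, hsumL]
    field_simp
  have hwsq (j : Fin n) (v : E) :
      w j * ‖(Lbar / Lc j) • v‖ ^ 2 = Lbar / n * (‖v‖ ^ 2 / Lc j) := by
    rw [norm_smul, mul_pow, Real.norm_eq_abs, sq_abs, pow_two (Lbar / Lc j), ← mul_assoc,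
      ← mul_assoc, hwL]
    ring
  have hmean (C : Fin n → E) :
      ∑ j, w j • (Lbar / Lc j) • (C j - S j) = (1 / n : ℝ) • ∑ j, C j := by
    simp only [smul_smul, hwL, ← Finset.smul_sum, Finset.sum_sub_distrib, hS, sub_zero]
  have hstep := sum_norm_sub_smul_estimator_sq_le w (fun j => (div_pos (hL j) hsum).le) hw1
    (fun j => (Lbar / Lc j) • (G j - S j)) (fun j => (Lbar / Lc j) • (H j - S j)) (x - xstar)
    (1 / (4 * Lbar))
  simp only [hmean, hwsq, ← smul_sub, sub_sub_sub_cancel_right, ← Finset.mul_sum,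
    real_inner_smul_left] at hstep
  have hupd := sum_sum_apply_update D φ x
  rw [Fintype.card_fin] at hupd
  have hsplit : ∑ a : Fin n × Fin n, w a.1 * (1 / n : ℝ) * sagaLyapunov D Lbar xstar
          (x - (1 / (4 * Lbar)) • ((Lbar / Lc a.1) • (G a.1 - H a.1) + (1 / n : ℝ) • ∑ i, H i))
          (Function.update φ a.2 x) =
      ∑ j, w j * ‖x - xstar - (1 / (4 * Lbar)) •
          ((Lbar / Lc j) • (G j - H j) + (1 / n : ℝ) • ∑ i, H i)‖ ^ 2
        + 1 / (2 * Lbar) * (1 / n) * ∑ r, ∑ i, D i (Function.update φ r x i) := by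
    have hprod (P Q : Fin n → ℝ) :
        ∑ a : Fin n × Fin n, w a.1 * (1 / n : ℝ) * (P a.1 + 1 / (2 * Lbar) * Q a.2) =
          ∑ j, w j * P j + 1 / (2 * Lbar) * (1 / n) * ∑ r, Q r := by
      have h1 (j : Fin n) : ∑ r, w j * (1 / n : ℝ) * (P j + 1 / (2 * Lbar) * Q r) =
          w j * P j + w j * (1 / (2 * Lbar) * (1 / n) * ∑ r, Q r) := by
        rw [← Finset.mul_sum, Finset.sum_add_distrib, ← Finset.mul_sum]
        simp
        field_simp
      rw [Fintype.sum_prod_type]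
      simp only [h1, Finset.sum_add_distrib, ← Finset.sum_mul, hw1, one_mul]
    simp only [sagaLyapunov, sub_right_comm _ _ xstar]
    exact hprod (fun j => ‖x - xstar - (1 / (4 * Lbar)) •
      ((Lbar / Lc j) • (G j - H j) + (1 / n : ℝ) • ∑ i, H i)‖ ^ 2)
      fun r => ∑ i, D i (Function.update φ r x i)
  rw [hsplit, hupd]
  have hHsum := Finset.sum_le_sum fun i (_ : i ∈ Finset.univ) => hH i
  have hGsum := Finset.sum_le_sum fun i (_ : i ∈ Finset.univ) => hG i
  simp only [← Finset.sum_div] at hHsum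
  rw [Finset.sum_add_distrib, ← sum_inner, Finset.sum_sub_distrib, hS, sub_zero,
    ← Finset.sum_div] at hGsum
  have hHnn : 0 ≤ ∑ i, ‖H i - S i‖ ^ 2 / Lc i :=
    Finset.sum_nonneg fun i _ => div_nonneg (sq_nonneg _) (hL i).le
  simp only [sagaLyapunov]
  generalize inner ℝ (∑ i, G i) (x - xstar) = Q at *
  generalize ∑ i, ‖G i - S i‖ ^ 2 / Lc i = SG at *
  generalize ∑ i, ‖H i - S i‖ ^ 2 / Lc i = SH at *
  generalize ∑ i, D i (φ i) = T at *
  generalize ∑ i, D i x = F at *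
  have hT : 0 ≤ T := by linarith
  have hm1 := min_le_left (1 / (3 * (n : ℝ))) (μ / (8 * Lbar))
  have hm2 := min_le_right (1 / (3 * (n : ℝ))) (μ / (8 * Lbar))
  generalize min (1 / (3 * (n : ℝ))) (μ / (8 * Lbar)) = m at *
  have hd : 0 ≤ ‖x - xstar‖ ^ 2 := sq_nonneg _
  generalize ‖x - xstar‖ ^ 2 = d at *
  have hmd := mul_le_mul_of_nonneg_right hm2 hd
  have hmT := mul_le_mul_of_nonneg_right hm1 (by positivity : 0 ≤ 1 / (2 * Lbar) * T)
  have hcomb : d - 2 * (1 / (4 * Lbar)) * (1 / n * Q)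
      + 2 * (1 / (4 * Lbar)) ^ 2 * (Lbar / n * SG + Lbar / n * SH)
      + 1 / (2 * Lbar) * (1 / n) * (n * T + F - T) ≤
      d - μ / (8 * Lbar) * d + 1 / (2 * Lbar) * T - 1 / (3 * n) * (1 / (2 * Lbar) * T) := by
    have hkey : 0 ≤ 1 / (24 * Lbar * n) * (12 * Q - 3 * SG - 3 * SH - 12 * F + 12 * T
        - 3 * n * μ * d - 4 * T) := by
      refine mul_nonneg (by positivity) ?_
      linarith
    rw [← sub_nonneg]
    convert hkey using 1
    field_simp
    ring
  linarith

end SagaStep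


/-- Proposition 1(b): linear convergence of SAGA with Lipschitz sampling, with
rate depending on the average Lipschitz constant. -/
theorem saga_lipschitz_sampling_linear_convergence
    {E : Type*} [NormedAddCommGroup E] [InnerProductSpace ℝ E] [CompleteSpace E]
    {n : ℕ} (hn : 1 ≤ n)
    (f : Fin n → E → ℝ) (Lc : Fin n → ℝ) (hL : ∀ i, 0 < Lc i)
    (hconv : ∀ i, ConvexOn ℝ Set.univ (f i))
    (hdiff : ∀ i, Differentiable ℝ (f i))
    (hlip : ∀ i, ∀ w v : E, ‖gradient (f i) w - gradient (f i) v‖ ≤ Lc i * ‖w - v‖)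
    (Lbar : ℝ) (hLbar : Lbar = (1 / n : ℝ) * ∑ i, Lc i)
    (fbar : E → ℝ) (hfbar : fbar = fun w => (1 / n : ℝ) * ∑ i, f i w)
    (μ : ℝ) (hμ : 0 < μ) (hμL : μ ≤ Lbar)
    (hsc : ConvexOn ℝ Set.univ (fun w => fbar w - μ / 2 * ‖w‖ ^ 2))
    (xstar : E) (hmin : ∀ w, fbar xstar ≤ fbar w)
    (p : Fin n → ℝ) (hp : ∀ j, p j = Lc j / ∑ i, Lc i)
    (α : ℝ) (hα : α = 1 / (4 * Lbar))
    (x0 : E)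
    -- the trajectory along each path of sampled pairs (gradient index, memory index)
    (x : (t : ℕ) → (Fin t → Fin n × Fin n) → E)
    (φ : (t : ℕ) → (Fin t → Fin n × Fin n) → Fin n → E)
    (hx0 : ∀ σ : Fin 0 → Fin n × Fin n, x 0 σ = x0)
    (hφ0 : ∀ (σ : Fin 0 → Fin n × Fin n) (i : Fin n), φ 0 σ i = x0)
    (hxrec : ∀ (t : ℕ) (σ : Fin (t + 1) → Fin n × Fin n),
      x (t + 1) σ = x t (σ ∘ Fin.castSucc) - α •
        ((Lbar / Lc (σ (Fin.last t)).1) •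
            (gradient (f (σ (Fin.last t)).1) (x t (σ ∘ Fin.castSucc))
              - gradient (f (σ (Fin.last t)).1) (φ t (σ ∘ Fin.castSucc) (σ (Fin.last t)).1))
          + (1 / n : ℝ) • ∑ i, gradient (f i) (φ t (σ ∘ Fin.castSucc) i)))
    (hφrec : ∀ (t : ℕ) (σ : Fin (t + 1) → Fin n × Fin n),
      φ (t + 1) σ = Function.update (φ t (σ ∘ Fin.castSucc)) (σ (Fin.last t)).2
        (x t (σ ∘ Fin.castSucc)))
    (Cb : ℝ) (hCb : Cb = (n / (2 * Lbar)) * (fbar x0 - fbar xstar)) :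
    ∀ t : ℕ, ∑ σ : Fin t → Fin n × Fin n,
        (∏ k, p (σ k).1 * (1 / n : ℝ)) * ‖x t σ - xstar‖ ^ 2 ≤
      (1 - min (1 / (3 * (n : ℝ))) (μ / (8 * Lbar))) ^ t * (‖x0 - xstar‖ ^ 2 + Cb) := by
  have hn0 : (0 : ℝ) < n := by exact_mod_cast hn
  have hLb : 0 < Lbar := hμ.trans_le hμL
  have hgrad (w : E) : HasGradientAt fbar ((1 / n : ℝ) • ∑ i, gradient (f i) w) w := by
    rw [hasGradientAt_iff_hasFDerivAt, map_smul, map_sum, hfbar]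
    exact (HasFDerivAt.fun_sum fun i _ => (hdiff i w).hasGradientAt.hasFDerivAt).const_mul _
  have hS : ∑ i, gradient (f i) xstar = 0 := by
    have h := IsLocalMin.hasFDerivAt_eq_zero (Filter.Eventually.of_forall hmin)
      (hgrad xstar).hasFDerivAt
    rw [map_eq_zero_iff _ (InnerProductSpace.toDual ℝ E).injective] at h
    exact (smul_eq_zero.1 h).resolve_left (by positivity)
  let D : Fin n → E → ℝ := fun i z =>
    f i z - f i xstar - inner ℝ (gradient (f i) xstar) (z - xstar)
  have hDlower (i : Fin n) (z : E) :
      ‖gradient (f i) z - gradient (f i) xstar‖ ^ 2 / Lc i / 2 ≤ D i z := by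
    have h := (hconv i).add_inner_gradient_add_sq_le (hL i) (hdiff i) (hlip i) xstar z
    simp only [D]
    linarith
  have hDnonneg (i : Fin n) (z : E) : 0 ≤ D i z :=
    (div_nonneg (div_nonneg (sq_nonneg _) (hL i).le) zero_le_two).trans (hDlower i z)
  have hDsum (z : E) : ∑ i, D i z = n * (fbar z - fbar xstar) := by
    simp only [D, Finset.sum_sub_distrib, ← sum_inner, hS, inner_zero_left, hfbar]
    field_simp
    ring
  have hDupper (i : Fin n) (z : E) :
      D i z + ‖gradient (f i) z - gradient (f i) xstar‖ ^ 2 / Lc i / 2 ≤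
        inner ℝ (gradient (f i) z - gradient (f i) xstar) (z - xstar) := by
    have h := (hconv i).add_inner_gradient_add_sq_le (hL i) (hdiff i) (hlip i) z xstar
    rw [norm_sub_rev, ← neg_sub z xstar, inner_neg_right] at h
    simp only [D, inner_sub_left]
    linarith
  have hstrong (z : E) : ∑ i, D i z + n * (μ / 2 * ‖z - xstar‖ ^ 2) ≤
      inner ℝ (∑ i, gradient (f i) z) (z - xstar) := by
    have h := hsc.add_inner_add_sq_le (hgrad z) xstar
    rw [norm_sub_rev, ← neg_sub z xstar, inner_neg_right, real_inner_smul_left] at h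
    have h' := mul_le_mul_of_nonneg_left h hn0.le
    rw [hDsum]
    have hcancel : (n : ℝ) * (1 / n * inner ℝ (∑ i, gradient (f i) z) (z - xstar)) =
        inner ℝ (∑ i, gradient (f i) z) (z - xstar) := by field_simp
    linarith
  have hρ : 0 ≤ 1 - min (1 / (3 * (n : ℝ))) (μ / (8 * Lbar)) := by
    have h1 : (1 : ℝ) ≤ n := by exact_mod_cast hn
    have h2 : 1 / (3 * (n : ℝ)) ≤ 1 := (div_le_one (by positivity)).2 (by linarith)
    linarith [min_le_left (1 / (3 * (n : ℝ))) (μ / (8 * Lbar))]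
  have hw (a : Fin n × Fin n) : 0 ≤ p a.1 * (1 / n : ℝ) := by
    rw [hp]
    exact mul_nonneg (div_nonneg (hL _).le (Finset.sum_nonneg fun i _ => (hL i).le)) (by positivity)
  intro t
  have hdecay := sum_prod_mul_le_pow_mul (fun a : Fin n × Fin n => p a.1 * (1 / n : ℝ)) hw hρ
    (fun t σ => sagaLyapunov D Lbar xstar (x t σ) (φ t σ)) (fun t σ => by
      simp only [hxrec, hφrec, Fin.snoc_comp_castSucc, Fin.snoc_last, hp, hα]
      exact saga_lyapunov_step hn Lc hL hLbar D xstar (x t σ) (φ t σ)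
        (fun i => gradient (f i) (x t σ)) (fun i => gradient (f i) (φ t σ i))
        (fun i => gradient (f i) xstar) hS (fun i => hDlower i _) (fun i => hDupper i _)
        (hstrong _)) t
  have hinit : sagaLyapunov D Lbar xstar (x 0 Fin.elim0) (φ 0 Fin.elim0) =
      ‖x0 - xstar‖ ^ 2 + Cb := by
    simp only [sagaLyapunov, hx0, hφ0, hDsum, hCb]
    ring
  rw [hinit] at hdecay
  refine le_trans (Finset.sum_le_sum fun σ _ => mul_le_mul_of_nonneg_left ?_
    (Finset.prod_nonneg fun k _ => hw _)) hdecay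
  exact le_add_of_nonneg_right (mul_nonneg (by positivity)
    (Finset.sum_nonneg fun i _ => hDnonneg i _))
end
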